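/- Let K be a field, n ≥ 2, X the generic n×n matrix over K with entries in S = K[x_{ij}], R = S/(det X), M the cokernel of the R-linear map Rⁿ → Rⁿ given by adj(X)‾, and L^∨ the cokernel of the R-linear map given by X̄ᵀ (bars denote reduction mod det X). Every alternating n×n matrix A over S satisfies Ā·(image of adj(X)‾) ⊆ (image of X̄ᵀ) (since A·adj(X) = Xᵀ·B for some alternating B), hence induces an R-linear homomorphism M → L^∨. Then: (i) every R-linear homomorphism M → L^∨ is induced in this way by some alternating matrix A over S; and (ii) an alternating matrix A over S induces the zero homomorphism M → L^∨ if and only if A = Xᵀ·U·X for some alternating n×n matrix U over S. -/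

import Mathlib

open Matrix

noncomputable section

/-- The generic `n × n` matrix, whose `(i,j)` entry is the indeterminate `x_{ij}` of the
polynomial ring `S = K[x_{ij}]`. -/
def genericMatrix (K : Type*) [Field K] (n : ℕ) :
    Matrix (Fin n) (Fin n) (MvPolynomial (Fin n × Fin n) K) :=
  Matrix.of fun i j => MvPolynomial.X (i, j)

/-- The generic determinantal hypersurface ring `R = S/(det X)`. -/
abbrev genericDetRing (K : Type*) [Field K] (n : ℕ) :=
  MvPolynomial (Fin n × Fin n) K ⧸ Ideal.span {(genericMatrix K n).det}

/-- Reduction of a matrix over `S` modulo `det X`. -/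
def matBar {K : Type*} [Field K] {n : ℕ}
    (A : Matrix (Fin n) (Fin n) (MvPolynomial (Fin n × Fin n) K)) :
    Matrix (Fin n) (Fin n) (genericDetRing K n) :=
  A.map (Ideal.Quotient.mk _)

section Alternating

variable {S : Type*} [CommRing S] {n : ℕ}

/-- The submodule of alternating matrices. -/
def alternatingMatrices (S : Type*) [CommRing S] (n : ℕ) :
    Submodule S (Matrix (Fin n) (Fin n) S) where
  carrier := {A | Aᵀ = -A ∧ ∀ i, A i i = 0}
  add_mem' := by
    rintro A B ⟨hA, hA'⟩ ⟨hB, hB'⟩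
    refine ⟨?_, fun i => by simp [hA', hB']⟩
    rw [transpose_add, hA, hB]
    abel
  zero_mem' := by simp
  smul_mem' := by
    rintro c A ⟨hA, hA'⟩
    exact ⟨by rw [transpose_smul, hA, smul_neg], fun i => by simp [hA']⟩

theorem sub_transpose_mem_alternatingMatrices (B : Matrix (Fin n) (Fin n) S) :
    B - Bᵀ ∈ alternatingMatrices S n :=
  ⟨by simp, fun i => by simp⟩

theorem exists_eq_sub_transpose {A : Matrix (Fin n) (Fin n) S}
    (hA : A ∈ alternatingMatrices S n) : ∃ B : Matrix (Fin n) (Fin n) S, A = B - Bᵀ := by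
  obtain ⟨h, h'⟩ := hA
  refine ⟨of fun i j => if i < j then A i j else 0, ?_⟩
  ext i j
  have hji : A j i = - A i j := congrFun (congrFun h i) j
  rcases lt_trichotomy i j with hij | rfl | hij
  · simp [hij, hij.not_gt]
  · simp [h']
  · simp [hij, hij.not_gt, hji]

theorem transpose_mul_mul_mem_alternatingMatrices {A : Matrix (Fin n) (Fin n) S}
    (hA : A ∈ alternatingMatrices S n) (P : Matrix (Fin n) (Fin n) S) :
    Pᵀ * A * P ∈ alternatingMatrices S n := by
  obtain ⟨B, rfl⟩ := exists_eq_sub_transpose hA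
  convert sub_transpose_mem_alternatingMatrices (Pᵀ * B * P) using 1
  simp [mul_sub, sub_mul, Matrix.mul_assoc]

theorem mem_alternatingMatrices_of_smul_mem [IsDomain S] {A : Matrix (Fin n) (Fin n) S} {s : S}
    (hs : s ≠ 0) (h : s • A ∈ alternatingMatrices S n) : A ∈ alternatingMatrices S n := by
  obtain ⟨h, h'⟩ := h
  refine ⟨?_, fun i => ?_⟩
  · rw [transpose_smul, ← smul_neg] at h
    exact smul_right_injective _ hs h
  · exact (mul_eq_zero.mp (h' i)).resolve_left hs

/-- An alternating matrix with entries in `(s, t)` is a combination of alternating matrices. -/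
theorem exists_alternating_eq_smul_add_smul {A : Matrix (Fin n) (Fin n) S}
    (hA : A ∈ alternatingMatrices S n) {s t : S} (h : ∀ i j, ∃ a b, A i j = s * a + t * b) :
    ∃ P ∈ alternatingMatrices S n, ∃ Q ∈ alternatingMatrices S n, A = s • P + t • Q := by
  choose p q hpq using h
  let P : Matrix (Fin n) (Fin n) S := of fun i j => if i < j then p i j else 0
  let Q : Matrix (Fin n) (Fin n) S := of fun i j => if i < j then q i j else 0
  refine ⟨_, sub_transpose_mem_alternatingMatrices P, _,
    sub_transpose_mem_alternatingMatrices Q, ?_⟩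
  obtain ⟨h, h'⟩ := hA
  ext i j
  have hji : A j i = - A i j := congrFun (congrFun h i) j
  rcases lt_trichotomy i j with hij | rfl | hij
  · simp [P, Q, hij, hij.not_gt, hpq i j]
  · simp [P, Q, h']
  · have := hpq j i
    simp only [P, Q, Matrix.add_apply, Matrix.smul_apply, Matrix.sub_apply, transpose_apply,
      of_apply, hij, hij.not_gt, if_true, if_false, smul_eq_mul]
    linear_combination hji - this

end Alternating

section Adjugate

variable {S : Type*} [CommRing S] {n : ℕ}

/-- Modulo the left multiples of `X`, the scalar matrix of an entry of `adj X` has rank one. -/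
theorem exists_adjugate_smul_one_eq (X : Matrix (Fin n) (Fin n) S) (j k : Fin n) :
    ∃ G : Matrix (Fin n) (Fin n) S, X.adjugate j k • (1 : Matrix (Fin n) (Fin n) S) =
      vecMulVec (fun i => X.adjugate i k) (Pi.single j 1) + G * X := by
  let Y := X.updateRow k (Pi.single j 1)
  have hY : Y.det = X.adjugate j k := (adjugate_apply X j k).symm
  have hc (a : Fin n) : Y.adjugate a k = X.adjugate a k := by
    rw [adjugate_apply, adjugate_apply, updateRow_idem]
  refine ⟨of fun a l => if l = k then 0 else Y.adjugate a l, ?_⟩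
  rw [← hY, ← adjugate_mul]
  ext a b
  rw [Matrix.add_apply, vecMulVec_apply, Matrix.mul_apply, Matrix.mul_apply,
    ← Finset.add_sum_erase _ _ (Finset.mem_univ k), ← Finset.add_sum_erase _ _ (Finset.mem_univ k)]
  simp only [of_apply, if_true, zero_mul, zero_add]
  congr 1
  · rw [hc]
    simp [Y]
  · refine Finset.sum_congr rfl fun l hl => ?_
    have hlk : l ≠ k := Finset.ne_of_mem_erase hl
    simp [Y, hlk]

/-- The `2 × 2` minors of the adjugate are divisible by the determinant. -/
theorem det_dvd_adjugate_minor (X : Matrix (Fin n) (Fin n) S) (i j k l : Fin n) :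
    X.det ∣ X.adjugate j k * X.adjugate i l - X.adjugate i k * X.adjugate j l := by
  obtain ⟨G, hG⟩ := exists_adjugate_smul_one_eq X j k
  have h := congrArg (· * X.adjugate) hG
  simp only [add_mul, Matrix.mul_assoc, mul_adjugate, Matrix.smul_mul, one_mul, vecMulVec_mul,
    Matrix.mul_smul, mul_one] at h
  have h' := congrFun (congrFun h i) l
  simp [vecMulVec_apply] at h'
  exact ⟨G i l, by linear_combination h'⟩

/-- If `T * adj X = Xᵀ * B`, then the square of each entry of `adj X` multiplies `T` into the sum
of the alternating matrices and the multiples of `Xᵀ`. -/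
theorem exists_adjugate_sq_smul_eq {X T B : Matrix (Fin n) (Fin n) S}
    (hT : T * X.adjugate = Xᵀ * B) (j k : Fin n) :
    ∃ A ∈ alternatingMatrices S n, ∃ W, (X.adjugate j k) ^ 2 • T = A + Xᵀ * W := by
  obtain ⟨G, hG⟩ := exists_adjugate_smul_one_eq X j k
  set s := X.adjugate j k
  set c : Fin n → S := fun i => X.adjugate i k
  set e : Fin n → S := Pi.single j 1
  have hTc : T *ᵥ c = Xᵀ *ᵥ (fun i => B i k) := by
    ext i; exact congrFun (congrFun hT i) k
  have hXc : X *ᵥ c = X.det • Pi.single k 1 := by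
    ext i
    have := congrFun (congrFun (mul_adjugate X) i) k
    change (X * X.adjugate) i k = _
    simpa [Matrix.one_apply, Pi.single_apply] using this
  have hkey : (vecMulVec c e)ᵀ * T * vecMulVec c e =
      Xᵀ * (X.adjugateᵀ * (B k k • vecMulVec e e)) := by
    have hq : c ⬝ᵥ (T *ᵥ c) = X.det * B k k := by
      rw [hTc, dotProduct_mulVec, vecMul_transpose, hXc]
      simp
    rw [← Matrix.mul_assoc, ← transpose_mul, adjugate_mul, transpose_smul, transpose_one,
      Matrix.smul_mul, one_mul, smul_smul, ← hq, transpose_vecMulVec, Matrix.mul_assoc, mul_vecMulVec,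
      vecMulVec_mul_vecMulVec]
    ext a b
    simp only [vecMulVec_apply, Matrix.smul_apply, smul_eq_mul, Pi.smul_apply]
    ring
  set Z := (vecMulVec c e)ᵀ * T * G
  refine ⟨Z * X - (Z * X)ᵀ, sub_transpose_mem_alternatingMatrices _,
    X.adjugateᵀ * (B k k • vecMulVec e e) + Zᵀ + Gᵀ * T * (vecMulVec c e + G * X), ?_⟩
  have hs : s ^ 2 • T = (s • (1 : Matrix (Fin n) (Fin n) S))ᵀ * T * (s • 1) := by
    simp [smul_smul, pow_two]
  rw [hs, hG, transpose_add, add_mul, add_mul, mul_add ((vecMulVec c e)ᵀ * T), hkey]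
  simp only [Z, mul_add, transpose_mul, Matrix.mul_assoc]
  abel

variable [IsDomain S]

theorem mul_right_cancel_of_det_ne_zero {X A B : Matrix (Fin n) (Fin n) S} (hX : X.det ≠ 0)
    (h : A * X = B * X) : A = B := by
  have h' := congrArg (· * X.adjugate) h
  simp only [Matrix.mul_assoc, mul_adjugate, Matrix.mul_smul, mul_one] at h'
  exact smul_right_injective _ hX h'

/-- If `det X` generates a radical ideal and `Xᵀ * C` is alternating, then `C = U * X` with `U`
alternating. -/
theorem exists_alternating_mul_eq {X C : Matrix (Fin n) (Fin n) S} (hX : X.det ≠ 0)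
    (hrad : ∀ a, X.det ∣ a ^ 2 → X.det ∣ a) (hC : Xᵀ * C ∈ alternatingMatrices S n) :
    ∃ U ∈ alternatingMatrices S n, C = U * X := by
  have hV : C * X.adjugate ∈ alternatingMatrices S n := by
    apply mem_alternatingMatrices_of_smul_mem hX
    convert transpose_mul_mul_mem_alternatingMatrices hC X.adjugate using 1
    rw [← Matrix.mul_assoc, ← transpose_mul, mul_adjugate, transpose_smul, transpose_one,
      Matrix.smul_mul, Matrix.smul_mul, one_mul]
  set V := C * X.adjugate with hVdef
  have hminor (i j : Fin n) : X.det ∣ V i j * V j i - V i i * V j j := by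
    simp only [hVdef, Matrix.mul_apply, Finset.sum_mul_sum, ← Finset.sum_sub_distrib]
    refine Finset.dvd_sum fun a _ => Finset.dvd_sum fun b _ => ?_
    convert (det_dvd_adjugate_minor X b a j i).mul_left (C i a * C j b) using 1
    ring
  have hdvd (i j : Fin n) : X.det ∣ V i j := by
    apply hrad
    have hji : V j i = - V i j := congrFun (congrFun hV.1 i) j
    have := hminor i j
    rw [hV.2 i, hji] at this
    convert this.neg_right using 1
    ring
  choose U hU using hdvd
  have hVU : V = X.det • of U := by ext i j; exact hU i j
  refine ⟨of U, mem_alternatingMatrices_of_smul_mem hX (hVU ▸ hV), ?_⟩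
  apply smul_right_injective _ hX
  change X.det • C = X.det • (of U * X)
  rw [← Matrix.smul_mul, ← hVU, hVdef, Matrix.mul_assoc, adjugate_mul, Matrix.mul_smul, mul_one]

/-- If three multiples of `T` by a regular sequence lie in the sum of the alternating matrices and
the multiples of `Xᵀ`, then so does `T`. -/
theorem exists_eq_alternating_add {X T : Matrix (Fin n) (Fin n) S} (hX : X.det ≠ 0)
    (hrad : ∀ a, X.det ∣ a ^ 2 → X.det ∣ a) {s₁ s₂ s₃ : S} (hs₁ : s₁ ≠ 0)
    (h₁₂ : ∀ a, s₁ ∣ s₂ * a → s₁ ∣ a)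
    (h₁₂₃ : ∀ u a b, s₃ * u = s₁ * a + s₂ * b → ∃ a b, u = s₁ * a + s₂ * b)
    (h₁ : ∃ A ∈ alternatingMatrices S n, ∃ W, s₁ • T = A + Xᵀ * W)
    (h₂ : ∃ A ∈ alternatingMatrices S n, ∃ W, s₂ • T = A + Xᵀ * W)
    (h₃ : ∃ A ∈ alternatingMatrices S n, ∃ W, s₃ • T = A + Xᵀ * W) :
    ∃ A ∈ alternatingMatrices S n, ∃ W, T = A + Xᵀ * W := by
  have syz {s t : S} {A A' W W' : Matrix (Fin n) (Fin n) S} (hA : A ∈ alternatingMatrices S n)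
      (hA' : A' ∈ alternatingMatrices S n) (h : s • T = A + Xᵀ * W)
      (h' : t • T = A' + Xᵀ * W') :
      ∃ U ∈ alternatingMatrices S n, t • W - s • W' = U * X := by
    apply exists_alternating_mul_eq hX hrad
    have : Xᵀ * (t • W - s • W') = s • A' - t • A := by
      have e₁ : Xᵀ * W = s • T - A := by rw [h]; abel
      have e₂ : Xᵀ * W' = t • T - A' := by rw [h']; abel
      rw [mul_sub, Matrix.mul_smul, Matrix.mul_smul, e₁, e₂, smul_sub, smul_sub, smul_comm s t T]
      abel
    rw [this]
    exact Submodule.sub_mem _ (Submodule.smul_mem _ _ hA') (Submodule.smul_mem _ _ hA)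
  obtain ⟨A₁, hA₁, W₁, e₁⟩ := h₁
  obtain ⟨A₂, hA₂, W₂, e₂⟩ := h₂
  obtain ⟨A₃, hA₃, W₃, e₃⟩ := h₃
  obtain ⟨U, hU, hUX⟩ := syz hA₁ hA₂ e₁ e₂
  obtain ⟨U₁₃, -, hUX₁₃⟩ := syz hA₁ hA₃ e₁ e₃
  obtain ⟨U₂₃, -, hUX₂₃⟩ := syz hA₂ hA₃ e₂ e₃
  have hrel : s₃ • U = s₁ • (-U₂₃) + s₂ • U₁₃ := by
    apply mul_right_cancel_of_det_ne_zero hX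
    rw [add_mul, Matrix.smul_mul, Matrix.smul_mul, Matrix.smul_mul, neg_mul, ← hUX,
      ← hUX₁₃, ← hUX₂₃]
    ext i j
    simp
    ring
  obtain ⟨P, hP, Q, hQ, rfl⟩ := exists_alternating_eq_smul_add_smul hU (s := s₁) (t := s₂)
    fun i j => h₁₂₃ _ _ _ (congrFun (congrFun hrel i) j)
  have hdvd (i j : Fin n) : s₁ ∣ (W₁ - Q * X) i j := by
    apply h₁₂
    refine ⟨(W₂ + P * X) i j, ?_⟩
    have := congrFun (congrFun hUX i) j
    simp only [add_mul, Matrix.smul_mul, Matrix.add_apply, Matrix.smul_apply, Matrix.sub_apply,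
      smul_eq_mul] at this ⊢
    linear_combination this
  choose W hW using hdvd
  have hW' : W₁ = Q * X + s₁ • of W := by
    ext i j
    have := hW i j
    simp only [Matrix.sub_apply, Matrix.add_apply, Matrix.smul_apply, of_apply,
      smul_eq_mul] at this ⊢
    linear_combination this
  refine ⟨T - Xᵀ * of W, ?_, of W, by abel⟩
  apply mem_alternatingMatrices_of_smul_mem hs₁
  rw [smul_sub, e₁, hW', mul_add, Matrix.mul_smul]
  convert Submodule.add_mem _ hA₁ (transpose_mul_mul_mem_alternatingMatrices hQ X) using 1
  rw [Matrix.mul_assoc]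
  abel

end Adjugate

section LeadingMonomials

open MvPolynomial MonomialOrder

theorem le_of_le_add_of_disjoint {σ : Type*} {a b c : σ →₀ ℕ} (hab : ∀ p, a p = 0 ∨ b p = 0)
    (h : a ≤ b + c) : a ≤ c := by
  intro p
  have h₁ := h p
  rw [Finsupp.add_apply] at h₁
  rcases hab p with h₂ | h₂ <;> omega

variable {σ K : Type*} [Field K] (m : MonomialOrder σ)

/-- A monic polynomial with squarefree leading monomial generates a radical ideal. -/
theorem dvd_of_dvd_sq_of_squarefree_degree {d a : MvPolynomial σ K} (hd : m.Monic d)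
    (hsq : ∀ p, m.degree d p ≤ 1) (h : d ∣ a ^ 2) : d ∣ a := by
  have hu : IsUnit (m.leadingCoeff d) := by rw [hd.leadingCoeff_eq_one]; exact isUnit_one
  obtain ⟨g, r, hgr, -, hr⟩ := m.div_single hu a
  have hdr : d ∣ r ^ 2 := by
    have : r ^ 2 = a ^ 2 - d * (g * (a + r)) := by rw [hgr]; ring
    rw [this]
    exact dvd_sub h (dvd_mul_right _ _)
  obtain rfl | hr0 := eq_or_ne r 0
  · exact ⟨g, by rw [hgr]; ring⟩
  · obtain ⟨q, hq⟩ := hdr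
    have hq0 : q ≠ 0 := by rintro rfl; simp [hr0] at hq
    have hdeg := congrArg m.degree hq
    rw [m.degree_pow, m.degree_mul hd.ne_zero hq0] at hdeg
    refine absurd (fun p => ?_) (hr _ (m.degree_mem_support hr0))
    have h₁ := DFunLike.congr_fun hdeg p
    simp only [Finsupp.smul_apply, Finsupp.add_apply, smul_eq_mul] at h₁
    have := hsq p
    omega

theorem dvd_of_dvd_mul_of_disjoint_degree {s t a : MvPolynomial σ K} (hs : m.Monic s)
    (ht : m.Monic t) (hst : ∀ p, m.degree s p = 0 ∨ m.degree t p = 0) (h : s ∣ t * a) : s ∣ a := by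
  have hu : IsUnit (m.leadingCoeff s) := by rw [hs.leadingCoeff_eq_one]; exact isUnit_one
  obtain ⟨g, r, hgr, -, hr⟩ := m.div_single hu a
  have hsr : s ∣ t * r := by
    have : t * r = t * a - s * (t * g) := by rw [hgr]; ring
    rw [this]
    exact dvd_sub h (dvd_mul_right _ _)
  obtain rfl | hr0 := eq_or_ne r 0
  · exact ⟨g, by rw [hgr]; ring⟩
  · obtain ⟨q, hq⟩ := hsr
    have hq0 : q ≠ 0 := by
      rintro rfl
      simp [hr0, ht.ne_zero] at hq
    have hdeg := congrArg m.degree hq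
    rw [m.degree_mul ht.ne_zero hr0, m.degree_mul hs.ne_zero hq0] at hdeg
    exact absurd (le_of_le_add_of_disjoint hst (hdeg ▸ le_self_add))
      (hr _ (m.degree_mem_support hr0))

/-- Three monic polynomials with pairwise coprime leading monomials: the third one is regular
modulo the first two. -/
theorem exists_eq_add_of_disjoint_degree {s₁ s₂ s₃ u a b : MvPolynomial σ K} (h₁ : m.Monic s₁)
    (h₂ : m.Monic s₂) (h₃ : m.Monic s₃) (h₁₂ : ∀ p, m.degree s₁ p = 0 ∨ m.degree s₂ p = 0)
    (h₁₃ : ∀ p, m.degree s₁ p = 0 ∨ m.degree s₃ p = 0)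
    (h₂₃ : ∀ p, m.degree s₂ p = 0 ∨ m.degree s₃ p = 0) (h : s₃ * u = s₁ * a + s₂ * b) :
    ∃ a b, u = s₁ * a + s₂ * b := by
  have hunit {s : MvPolynomial σ K} (hs : m.Monic s) : IsUnit (m.leadingCoeff s) := by
    rw [hs.leadingCoeff_eq_one]
    exact isUnit_one
  obtain ⟨g, r, hgr, -, hr⟩ := m.div (b := ![s₁, s₂])
    (by rw [Fin.forall_fin_two]; exact ⟨hunit h₁, hunit h₂⟩) u
  rw [Finsupp.linearCombination_apply, Finsupp.sum_fintype _ _ (by simp), Fin.sum_univ_two] at hgr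
  simp only [Matrix.cons_val_zero, Matrix.cons_val_one, smul_eq_mul] at hgr
  obtain ⟨c, b', hb, -, hb'⟩ := m.div_single (hunit h₁) (b - s₃ * g 1)
  obtain rfl | hr0 := eq_or_ne r 0
  · exact ⟨g 0, g 1, by rw [hgr]; ring⟩
  exfalso
  have hmem := hr _ (m.degree_mem_support hr0)
  rw [Fin.forall_fin_two] at hmem
  simp only [Matrix.cons_val_zero, Matrix.cons_val_one] at hmem
  have heq : s₃ * r = s₁ * (a - s₃ * g 0 + c * s₂) + s₂ * b' := by
    linear_combination h - s₃ * hgr + s₂ * hb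
  set a' := a - s₃ * g 0 + c * s₂
  have hdeg : m.degree (s₃ * r) = m.degree (s₁ * a' + s₂ * b') := by rw [heq]
  rw [m.degree_mul h₃.ne_zero hr0] at hdeg
  have case₁ (h : m.degree s₁ ≤ m.degree s₃ + m.degree r) : False :=
    hmem.1 (le_of_le_add_of_disjoint h₁₃ h)
  have case₂ (h : m.degree s₂ ≤ m.degree s₃ + m.degree r) : False :=
    hmem.2 (le_of_le_add_of_disjoint h₂₃ h)
  obtain ha0 | ha0 := eq_or_ne a' 0 <;> obtain rfl | hb0 := eq_or_ne b' 0
  · simp [ha0, hr0, h₃.ne_zero] at heq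
  · rw [ha0, mul_zero, zero_add, m.degree_mul h₂.ne_zero hb0] at hdeg
    exact case₂ (hdeg ▸ le_self_add)
  · rw [mul_zero, add_zero, m.degree_mul h₁.ne_zero ha0] at hdeg
    exact case₁ (hdeg ▸ le_self_add)
  · have hne : m.degree (s₁ * a') ≠ m.degree (s₂ * b') := by
      rw [m.degree_mul h₁.ne_zero ha0, m.degree_mul h₂.ne_zero hb0]
      intro h
      exact hb' _ (m.degree_mem_support hb0) (le_of_le_add_of_disjoint h₁₂ (h ▸ le_self_add))
    rcases lt_or_gt_of_ne (m.toSyn.injective.ne hne) with hlt | hlt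
    · rw [m.degree_add_eq_right_of_lt hlt, m.degree_mul h₂.ne_zero hb0] at hdeg
      exact case₂ (hdeg ▸ le_self_add)
    · rw [m.degree_add_of_lt hlt, m.degree_mul h₁.ne_zero ha0] at hdeg
      exact case₁ (hdeg ▸ le_self_add)

end LeadingMonomials

section GenericMinors

open MvPolynomial MonomialOrder

/-- The lexicographic order on monomials in the entries of a matrix, the entries being read row
by row. -/
def rowLex (n : ℕ) : MonomialOrder (Fin n × Fin n) where
  syn := Lex ((Fin n ×ₗ Fin n) →₀ ℕ)
  toSyn := (Finsupp.domCongr toLex).trans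
    { toEquiv := toLex
      map_add' := toLex_add }
  toSyn_monotone := fun _ _ h => Finsupp.toLex_monotone fun p => h (ofLex p)

theorem rowLex_lt_of_apply_lt {n : ℕ} {a b : (Fin n × Fin n) →₀ ℕ} (i j : Fin n)
    (hlt : ∀ p q, p < i ∨ p = i ∧ q < j → a (p, q) = b (p, q)) (hij : a (i, j) < b (i, j)) :
    a ≺[rowLex n] b := by
  refine Finsupp.Lex.lt_iff.mpr ⟨toLex (i, j), fun p hp => ?_, hij⟩
  obtain ⟨p, q⟩ := p
  exact hlt p q (Prod.Lex.lt_iff.mp hp)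

variable {n m : ℕ}

/-- The exponent of the monomial of the permutation `s` in the minor with rows `f` and
columns `g`. -/
def minorExponent (f g : Fin m → Fin n) (s : Equiv.Perm (Fin m)) : (Fin n × Fin n) →₀ ℕ :=
  ∑ i, Finsupp.single (f i, g (s i)) 1

theorem minorExponent_apply (f g : Fin m → Fin n) (s : Equiv.Perm (Fin m)) (p q : Fin n) :
    minorExponent f g s (p, q) = ∑ i, if f i = p ∧ g (s i) = q then 1 else 0 := by
  simp [minorExponent, Finsupp.finsetSum_apply, Finsupp.single_apply]

theorem minorExponent_apply_left {f : Fin m → Fin n} (hf : Function.Injective f)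
    (g : Fin m → Fin n) (s : Equiv.Perm (Fin m)) (i : Fin m) (q : Fin n) :
    minorExponent f g s (f i, q) = if g (s i) = q then 1 else 0 := by
  rw [minorExponent_apply, Finset.sum_eq_single i]
  · simp
  · intro j _ hj
    simp [hf.ne hj]
  · simp

theorem minorExponent_one_le_one {f : Fin m → Fin n} (hf : Function.Injective f)
    (g : Fin m → Fin n) (p : Fin n × Fin n) : minorExponent f g 1 p ≤ 1 := by
  obtain ⟨p, q⟩ := p
  by_cases h : ∃ i, f i = p
  · obtain ⟨i, rfl⟩ := h
    rw [minorExponent_apply_left hf]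
    split_ifs <;> simp
  · rw [minorExponent_apply, Finset.sum_eq_zero]
    · simp
    · exact fun i _ => if_neg fun hi => h ⟨i, hi.1⟩

theorem minorExponent_lt {f g : Fin m → Fin n} (hf : StrictMono f) (hg : StrictMono g)
    {s : Equiv.Perm (Fin m)} (hs : s ≠ 1) :
    minorExponent f g s ≺[rowLex n] minorExponent f g 1 := by
  have hex : ∃ i, s i ≠ i := by
    by_contra! h
    exact hs (Equiv.ext h)
  obtain ⟨i, hi, hmin⟩ : ∃ i, s i ≠ i ∧ ∀ j < i, s j = j := by
    obtain ⟨i, hi, hmin⟩ := WellFounded.has_min (wellFounded_lt (α := Fin m)) {i | s i ≠ i} hex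
    exact ⟨i, hi, fun j hj => by_contra fun h => hmin j h hj⟩
  have hlt : i < s i := by
    refine lt_of_le_of_ne (not_lt.mp fun h => ?_) hi.symm
    exact hi (s.injective (hmin _ h))
  apply rowLex_lt_of_apply_lt (f i) (g i)
  · rintro p q (hp | ⟨rfl, hq⟩)
    · by_cases h : ∃ j, f j = p
      · obtain ⟨j, rfl⟩ := h
        rw [minorExponent_apply_left hf.injective, minorExponent_apply_left hf.injective,
          hmin j (hf.lt_iff_lt.mp hp), Equiv.Perm.one_apply]
      · have (t : Equiv.Perm (Fin m)) : minorExponent f g t (p, q) = 0 := by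
          rw [minorExponent_apply]
          exact Finset.sum_eq_zero fun j _ => if_neg fun hj => h ⟨j, hj.1⟩
        rw [this, this]
    · rw [minorExponent_apply_left hf.injective, minorExponent_apply_left hf.injective,
        if_neg (hq.trans (hg hlt)).ne', Equiv.Perm.one_apply, if_neg hq.ne']
  · rw [minorExponent_apply_left hf.injective, minorExponent_apply_left hf.injective,
      if_neg (hg.injective.ne hi), Equiv.Perm.one_apply, if_pos rfl]
    exact zero_lt_one

variable (K : Type*) [Field K]

theorem det_submatrix_genericMatrix (f g : Fin m → Fin n) :
    ((genericMatrix K n).submatrix f g).det =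
      ∑ s : Equiv.Perm (Fin m), monomial (minorExponent f g s) ((Equiv.Perm.sign s : ℤ) : K) := by
  rw [← det_transpose, det_apply']
  refine Finset.sum_congr rfl fun s _ => ?_
  simp only [transpose_apply, submatrix_apply, genericMatrix, of_apply]
  have : ∏ i, (X (f i, g (s i)) : MvPolynomial (Fin n × Fin n) K) =
      monomial (minorExponent f g s) 1 := by
    rw [minorExponent, monomial_sum_one]
    rfl
  rw [this, ← mul_one ((Equiv.Perm.sign s : ℤ) : K), ← C_mul_monomial, map_intCast]

theorem coeff_minorExponent_one {f g : Fin m → Fin n} (hf : StrictMono f) (hg : StrictMono g) :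
    ((genericMatrix K n).submatrix f g).det.coeff (minorExponent f g 1) = 1 := by
  rw [det_submatrix_genericMatrix, coeff_sum, Finset.sum_eq_single 1]
  · simp
  · intro s _ hs
    rw [coeff_monomial, if_neg]
    intro h
    exact (minorExponent_lt hf hg hs).ne (by rw [h])
  · simp

theorem degree_det_submatrix_genericMatrix {f g : Fin m → Fin n} (hf : StrictMono f)
    (hg : StrictMono g) :
    (rowLex n).degree ((genericMatrix K n).submatrix f g).det = minorExponent f g 1 := by
  apply (rowLex n).toSyn.injective
  apply le_antisymm
  · rw [degree_le_iff, det_submatrix_genericMatrix]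
    intro c hc
    obtain ⟨s, -, hs⟩ := Finset.mem_biUnion.mp (support_sum hc)
    rw [Finset.mem_singleton.mp (support_monomial_subset hs)]
    obtain rfl | hs := eq_or_ne s 1
    · exact le_rfl
    · exact (minorExponent_lt hf hg hs).le
  · apply le_degree
    rw [mem_support_iff, coeff_minorExponent_one K hf hg]
    exact one_ne_zero

theorem monic_det_submatrix_genericMatrix {f g : Fin m → Fin n} (hf : StrictMono f)
    (hg : StrictMono g) : (rowLex n).Monic ((genericMatrix K n).submatrix f g).det := by
  rw [MonomialOrder.Monic, MonomialOrder.leadingCoeff, degree_det_submatrix_genericMatrix K hf hg,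
    coeff_minorExponent_one K hf hg]

theorem minorExponent_eq_zero_or {f g f' g' : Fin m → Fin n}
    (h : ∀ i j, ¬(f i = f' j ∧ g i = g' j)) (p : Fin n × Fin n) :
    minorExponent f g 1 p = 0 ∨ minorExponent f' g' 1 p = 0 := by
  obtain ⟨p, q⟩ := p
  by_contra! hne
  rw [minorExponent_apply, minorExponent_apply] at hne
  obtain ⟨i, -, hi⟩ := Finset.exists_ne_zero_of_sum_ne_zero hne.1
  obtain ⟨j, -, hj⟩ := Finset.exists_ne_zero_of_sum_ne_zero hne.2
  replace hi := of_not_not fun h => hi (if_neg h)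
  replace hj := of_not_not fun h => hj (if_neg h)
  exact h i j ⟨hi.1.trans hj.1.symm, hi.2.trans hj.2.symm⟩

theorem det_genericMatrix_ne_zero : (genericMatrix K n).det ≠ 0 :=
  (monic_det_submatrix_genericMatrix K (strictMono_id (α := Fin n)) strictMono_id).ne_zero

theorem det_genericMatrix_dvd_of_dvd_sq (a : MvPolynomial (Fin n × Fin n) K)
    (h : (genericMatrix K n).det ∣ a ^ 2) : (genericMatrix K n).det ∣ a := by
  have hid : StrictMono (id : Fin n → Fin n) := strictMono_id
  refine dvd_of_dvd_sq_of_squarefree_degree (rowLex n)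
    (monic_det_submatrix_genericMatrix K hid hid) (fun p => ?_) h
  rw [← submatrix_id_id (genericMatrix K n), degree_det_submatrix_genericMatrix K hid hid]
  exact minorExponent_one_le_one Function.injective_id _ p

/-- A matrix over `S` which induces a map `coker (adj X) → coker Xᵀ` is alternating modulo the
image of `Xᵀ`. -/
theorem exists_eq_alternating_add_of_mul_adjugate_eq (hn : 2 ≤ n)
    {T B : Matrix (Fin n) (Fin n) (MvPolynomial (Fin n × Fin n) K)}
    (hT : T * (genericMatrix K n).adjugate = (genericMatrix K n)ᵀ * B) :
    ∃ A ∈ alternatingMatrices (MvPolynomial (Fin n × Fin n) K) n,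
      ∃ W, T = A + (genericMatrix K n)ᵀ * W := by
  obtain ⟨n, rfl⟩ : ∃ k, n = k + 1 := ⟨n - 1, by omega⟩
  have hzero : StrictMono (Fin.succAbove (0 : Fin (n + 1))) := Fin.strictMono_succAbove _
  have hlast : StrictMono (Fin.succAbove (Fin.last n)) := Fin.strictMono_succAbove _
  have key (j k : Fin (n + 1)) := exists_adjugate_sq_smul_eq hT j k
  have hsq (j k : Fin (n + 1)) : (genericMatrix K (n + 1)).adjugate j k ^ 2 =
      ((genericMatrix K (n + 1)).submatrix k.succAbove j.succAbove).det ^ 2 := by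
    rw [adjugate_fin_succ_eq_det_submatrix, mul_pow, ← pow_mul, mul_comm _ 2, pow_mul]
    simp
  simp only [hsq] at key
  have disj {f g f' g' : Fin n → Fin (n + 1)} (hf : StrictMono f) (hg : StrictMono g)
      (hf' : StrictMono f') (hg' : StrictMono g') (h : ∀ i j, ¬(f i = f' j ∧ g i = g' j))
      (p : Fin (n + 1) × Fin (n + 1)) :
      (rowLex (n + 1)).degree (((genericMatrix K (n + 1)).submatrix f g).det ^ 2) p = 0 ∨
      (rowLex (n + 1)).degree (((genericMatrix K (n + 1)).submatrix f' g').det ^ 2) p = 0 := by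
    rw [degree_pow, degree_pow, degree_det_submatrix_genericMatrix K hf hg,
      degree_det_submatrix_genericMatrix K hf' hg']
    simpa using minorExponent_eq_zero_or h p
  have mon {f g : Fin n → Fin (n + 1)} (hf : StrictMono f) (hg : StrictMono g) :=
    (monic_det_submatrix_genericMatrix K hf hg).pow (n := 2)
  have h₁₂ := disj hzero hlast hlast hzero (by simp [Fin.ext_iff]; omega)
  have h₁₃ := disj hzero hlast hlast hlast (by simp [Fin.ext_iff]; omega)
  have h₂₃ := disj hlast hzero hlast hlast (by simp [Fin.ext_iff]; omega)
  exact exists_eq_alternating_add (det_genericMatrix_ne_zero K)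
    (det_genericMatrix_dvd_of_dvd_sq K) (mon hzero hlast).ne_zero
    (fun a => dvd_of_dvd_mul_of_disjoint_degree _ (mon hzero hlast) (mon hlast hzero) h₁₂)
    (fun u a b => exists_eq_add_of_disjoint_degree _ (mon hzero hlast) (mon hlast hzero)
      (mon hlast hlast) h₁₂ h₁₃ h₂₃)
    (key _ _) (key _ _) (key _ _)

end GenericMinors

section Cokernel

variable {K : Type*} [Field K] {n : ℕ}

theorem matBar_mul (A B : Matrix (Fin n) (Fin n) (MvPolynomial (Fin n × Fin n) K)) :
    matBar (A * B) = matBar A * matBar B :=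
  Matrix.map_mul

theorem matBar_add (A B : Matrix (Fin n) (Fin n) (MvPolynomial (Fin n × Fin n) K)) :
    matBar (A + B) = matBar A + matBar B :=
  Matrix.map_add _ (map_add _) A B

theorem exists_matBar_mulVec_single_eq (f : Fin n → Fin n → genericDetRing K n) :
    ∃ T : Matrix (Fin n) (Fin n) (MvPolynomial (Fin n × Fin n) K),
      ∀ j, matBar T *ᵥ Pi.single j 1 = f j := by
  choose t ht using fun i j => Ideal.Quotient.mk_surjective (f j i)
  refine ⟨of t, fun j => ?_⟩
  rw [mulVec_single_one]
  ext i
  exact ht i j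

theorem matBar_transpose_mul_mulVec_mem
    (B : Matrix (Fin n) (Fin n) (MvPolynomial (Fin n × Fin n) K)) (v : Fin n → genericDetRing K n) :
    matBar ((genericMatrix K n)ᵀ * B) *ᵥ v ∈
      LinearMap.range (mulVecLin (matBar (genericMatrix K n)ᵀ)) :=
  ⟨matBar B *ᵥ v, by rw [mulVecLin_apply, mulVec_mulVec, matBar_mul]⟩

/-- A matrix over `S` whose reduction has image in that of `Xᵀ` is a multiple of `Xᵀ`. -/
theorem exists_eq_transpose_mul_of_mulVec_mem
    {P : Matrix (Fin n) (Fin n) (MvPolynomial (Fin n × Fin n) K)}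
    (h : ∀ v, matBar P *ᵥ v ∈ LinearMap.range (mulVecLin (matBar (genericMatrix K n)ᵀ))) :
    ∃ B, P = (genericMatrix K n)ᵀ * B := by
  choose f hf using fun j => h (Pi.single j 1)
  obtain ⟨C, hC⟩ := exists_matBar_mulVec_single_eq f
  have hdvd (i j : Fin n) :
      ∃ d, d * (genericMatrix K n).det = (P - (genericMatrix K n)ᵀ * C) i j := by
    have hij := congrFun (hf j) i
    rw [← hC, mulVecLin_apply, mulVec_mulVec, ← matBar_mul, mulVec_single_one,
      mulVec_single_one] at hij
    exact Ideal.mem_span_singleton'.mp (Ideal.Quotient.eq.mp hij.symm)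
  choose D hD using hdvd
  refine ⟨C + (genericMatrix K n).adjugateᵀ * of D, ?_⟩
  rw [mul_add, ← Matrix.mul_assoc, ← transpose_mul, adjugate_mul, transpose_smul, transpose_one,
    Matrix.smul_mul, one_mul, ← sub_eq_iff_eq_add']
  ext i j : 2
  rw [← hD, Matrix.smul_apply, of_apply, smul_eq_mul, mul_comm]

end Cokernel

set_option synthInstance.maxHeartbeats 1000000 in
set_option maxHeartbeats 1000000 in
/-- Let `K` be a field, `n ≥ 2`, `R = S/(det X)`,
`M = coker(adj(X)‾ : Rⁿ → Rⁿ)` and `L^∨ = coker(X̄ᵀ : Rⁿ → Rⁿ)`.  Every alternating `n × n`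
matrix `A` over `S` induces an `R`-linear map `M → L^∨` (characterized by commutation with the
quotient projections).  Then: (i) every `R`-linear map `M → L^∨` is induced by some alternating
matrix `A` over `S`; and (ii) an alternating `A` induces the zero map if and only if
`A = Xᵀ * U * X` for some alternating matrix `U` over `S`. -/
theorem statement16 (K : Type*) [Field K] (n : ℕ) (hn : 2 ≤ n) :
    letI R := genericDetRing K n
    letI M := (Fin n → R) ⧸ LinearMap.range (Matrix.mulVecLin (matBar (genericMatrix K n).adjugate))
    letI Ldual := (Fin n → R) ⧸ LinearMap.range (Matrix.mulVecLin (matBar (genericMatrix K n)ᵀ))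
    (∀ φ : M →ₗ[R] Ldual,
      ∃ A : Matrix (Fin n) (Fin n) (MvPolynomial (Fin n × Fin n) K),
        (Aᵀ = -A ∧ ∀ i, A i i = 0) ∧
        φ ∘ₗ (LinearMap.range (Matrix.mulVecLin (matBar (genericMatrix K n).adjugate))).mkQ =
          (LinearMap.range (Matrix.mulVecLin (matBar (genericMatrix K n)ᵀ))).mkQ ∘ₗ
            Matrix.mulVecLin (matBar A)) ∧
    (∀ A : Matrix (Fin n) (Fin n) (MvPolynomial (Fin n × Fin n) K),
      (Aᵀ = -A ∧ ∀ i, A i i = 0) →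
      ((LinearMap.range (Matrix.mulVecLin (matBar (genericMatrix K n)ᵀ))).mkQ ∘ₗ
          Matrix.mulVecLin (matBar A) = 0 ↔
        ∃ U : Matrix (Fin n) (Fin n) (MvPolynomial (Fin n × Fin n) K),
          (Uᵀ = -U ∧ ∀ i, U i i = 0) ∧
          A = (genericMatrix K n)ᵀ * U * genericMatrix K n)) := by
  refine ⟨fun φ => ?_, fun A hA => ⟨fun h => ?_, ?_⟩⟩
  · choose f hf using fun j : Fin n => Submodule.mkQ_surjective _
      (φ (Submodule.mkQ _ (Pi.single j 1)))
    obtain ⟨T, hT⟩ := exists_matBar_mulVec_single_eq f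
    have hφ : φ ∘ₗ
        (LinearMap.range (mulVecLin (matBar (genericMatrix K n).adjugate))).mkQ =
          (LinearMap.range (mulVecLin (matBar (genericMatrix K n)ᵀ))).mkQ ∘ₗ
            mulVecLin (matBar T) := by
      refine (Pi.basisFun _ (Fin n)).ext fun j => ?_
      rw [Pi.basisFun_apply, LinearMap.comp_apply, LinearMap.comp_apply, mulVecLin_apply, hT, hf]
    obtain ⟨B, hB⟩ := exists_eq_transpose_mul_of_mulVec_mem
      (P := T * (genericMatrix K n).adjugate) fun v => by
        rw [matBar_mul, ← mulVec_mulVec, ← Submodule.Quotient.mk_eq_zero]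
        have hv := LinearMap.congr_fun hφ (matBar (genericMatrix K n).adjugate *ᵥ v)
        refine hv.symm.trans ?_
        rw [LinearMap.comp_apply, Submodule.mkQ_apply, (Submodule.Quotient.mk_eq_zero _).mpr,
          map_zero]
        exact ⟨v, rfl⟩
    obtain ⟨A, hA, W, rfl⟩ := exists_eq_alternating_add_of_mul_adjugate_eq K hn hB
    refine ⟨A, hA, hφ.trans (LinearMap.ext fun v => ?_)⟩
    refine (Submodule.Quotient.eq _).mpr ?_
    rw [mulVecLin_apply, mulVecLin_apply, matBar_add, add_mulVec, add_sub_cancel_left]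
    exact matBar_transpose_mul_mulVec_mem W v
  · obtain ⟨C, rfl⟩ := exists_eq_transpose_mul_of_mulVec_mem (P := A) fun v =>
      (Submodule.Quotient.mk_eq_zero _).mp (LinearMap.congr_fun h v)
    obtain ⟨U, hU, rfl⟩ := exists_alternating_mul_eq (det_genericMatrix_ne_zero K)
      (det_genericMatrix_dvd_of_dvd_sq K) hA
    exact ⟨U, hU, (Matrix.mul_assoc _ _ _).symm⟩
  · rintro ⟨U, -, rfl⟩
    refine LinearMap.ext fun v => (Submodule.Quotient.mk_eq_zero _).mpr ?_
    rw [mulVecLin_apply, Matrix.mul_assoc]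
    exact matBar_transpose_mul_mulVec_mem _ v

end
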